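/- Let p ∈ 𝔓_>([L]), p' ∈ 𝔓_>([L]), and let X_1, X_2, X_3 be invertible real L×L matrices such that p^{(2)} = (X_i⊗X_j) p'^{(2)} holds for every ordered pair of distinct indices i, j ∈ {1,2,3}. Then X_1 = X_2 = X_3. -/

import Mathlib

open scoped BigOperators

/-- `p` is a probability distribution on `Fin L`. -/
def probDist {L : ℕ} (p : Fin L → ℝ) : Prop :=
  (∀ i, 0 ≤ p i) ∧ ∑ i, p i = 1

/-- `p` is a probability distribution on `Fin L` with all entries strictly positive. -/
def probPos {L : ℕ} (p : Fin L → ℝ) : Prop :=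
  (∀ i, 0 < p i) ∧ ∑ i, p i = 1

/-- `p^{(K)}`: the function on `[L]^K` equal to `p i` on the constant tuple `(i,…,i)`
and `0` elsewhere. -/
def diagEmbed {L : ℕ} (p : Fin L → ℝ) (K : ℕ) : (Fin K → Fin L) → ℝ :=
  fun y => ∑ i, if (∀ k, y k = i) then p i else 0

/-- The action of `X_1 ⊗ … ⊗ X_K` on functions `[L]^K → ℝ`. -/
def tensorAct {L L' K : ℕ} (X : Fin K → Matrix (Fin L') (Fin L) ℝ)
    (v : (Fin K → Fin L) → ℝ) : (Fin K → Fin L') → ℝ :=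
  fun y => ∑ x : Fin K → Fin L, v x * ∏ k, X k (y k) (x k)

/-- A channel from `[L]` to `[L']`: an `L' × L` column-stochastic matrix. -/
def isChannel {L L' : ℕ} (W : Matrix (Fin L') (Fin L) ℝ) : Prop :=
  (∀ i j, 0 ≤ W i j) ∧ ∀ j, ∑ i, W i j = 1

/-- A tensor product of matrices applied to a diagonal tensor. -/
theorem tensorAct_diagEmbed {L L' K : ℕ} (X : Fin K → Matrix (Fin L') (Fin L) ℝ)
    (q : Fin L → ℝ) (y : Fin K → Fin L') :
    tensorAct X (diagEmbed q K) y = ∑ c, q c * ∏ k, X k (y k) c := by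
  unfold tensorAct diagEmbed
  simp_rw [Finset.sum_mul]
  rw [Finset.sum_comm]
  refine Finset.sum_congr rfl fun c _ => ?_
  have h (x : Fin K → Fin L) : (∀ k, x k = c) ↔ x = fun _ => c := funext_iff.symm
  simp [h, ite_mul]

/-- For order two, the action is `diag q ↦ A (diag q) Bᵀ`. -/
theorem tensorAct_diagEmbed_two {L L' : ℕ} (A B : Matrix (Fin L') (Fin L) ℝ)
    (q : Fin L → ℝ) (a b : Fin L') :
    tensorAct ![A, B] (diagEmbed q 2) ![a, b] =
      (A * (Matrix.diagonal q * B.transpose)) a b := by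
  rw [tensorAct_diagEmbed, Matrix.mul_apply]
  refine Finset.sum_congr rfl fun c _ => ?_
  simp [Fin.prod_univ_two, Matrix.diagonal_mul]
  ring

theorem pairwise_equations_force_equal_matrices (L : ℕ) (hL : 1 ≤ L)
    (p p' : Fin L → ℝ) (hp : probPos p) (hp' : probPos p')
    (X : Fin 3 → Matrix (Fin L) (Fin L) ℝ) (hX : ∀ k, IsUnit (X k))
    (heq : ∀ i j : Fin 3, i ≠ j →
      diagEmbed p 2 = tensorAct ![X i, X j] (diagEmbed p' 2)) :
    ∀ i j : Fin 3, X i = X j := by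
  intro i j
  obtain ⟨k, hik, hjk⟩ : ∃ k : Fin 3, i ≠ k ∧ j ≠ k := by decide +revert
  have hD : IsUnit (Matrix.diagonal p') := by
    rw [Matrix.isUnit_diagonal, Pi.isUnit_iff]
    exact fun c => (hp'.1 c).ne'.isUnit
  have hT : IsUnit (X k).transpose := (Matrix.isUnit_transpose _).2 (hX k)
  refine (hD.mul hT).mul_right_cancel ?_
  ext a b
  rw [← tensorAct_diagEmbed_two, ← tensorAct_diagEmbed_two, ← heq i k hik, ← heq j k hjk]
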